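/- Let G be a planar simple graph on n ≥ 11 vertices whose maximum matching has size 4, and suppose there exists a vertex subset S with |S| ≤ 1 such that the number of odd components of G − S equals n − 8 + |S| (a Tutte–Berge witness set for G). Then G has at most 2n edges. -/

import Mathlib

/-- A topological planar embedding of a simple graph `G`: an injective placement `f` of the
vertices in the plane together with, for each edge, an arc `γ e : ℝ → ℝ × ℝ` that is
continuous and injective on `[0,1]`, joins the images of the two endpoints of the edge,
whose interior avoids all vertex images, and such that interiors of distinct arcs are
pairwise disjoint. -/
def SimpleGraph.IsPlanarEmbedding {V : Type*} (G : SimpleGraph V) (f : V → ℝ × ℝ)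
    (γ : G.edgeSet → ℝ → ℝ × ℝ) : Prop :=
  Function.Injective f ∧
  (∀ e : G.edgeSet, ContinuousOn (γ e) (Set.Icc 0 1)) ∧
  (∀ e : G.edgeSet, Set.InjOn (γ e) (Set.Icc 0 1)) ∧
  (∀ e : G.edgeSet, ∃ u v : V, (e : Sym2 V) = s(u, v) ∧ γ e 0 = f u ∧ γ e 1 = f v) ∧
  (∀ e : G.edgeSet, ∀ t ∈ Set.Ioo (0 : ℝ) 1, ∀ v : V, γ e t ≠ f v) ∧
  (∀ e₁ e₂ : G.edgeSet, e₁ ≠ e₂ → ∀ t₁ ∈ Set.Ioo (0 : ℝ) 1, ∀ t₂ ∈ Set.Ioo (0 : ℝ) 1,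
      γ e₁ t₁ ≠ γ e₂ t₂)

/-- A simple graph is planar if it admits a topological planar embedding. -/
def SimpleGraph.IsPlanar {V : Type*} (G : SimpleGraph V) : Prop :=
  ∃ f γ, G.IsPlanarEmbedding f γ

/-- A plane triangulation on `n` vertices: a maximal planar simple graph on `n ≥ 3`
vertices, i.e. a planar graph with exactly `3n - 6` edges. -/
def IsPlaneTriangulation {n : ℕ} (G : SimpleGraph (Fin n)) : Prop :=
  3 ≤ n ∧ G.IsPlanar ∧ G.edgeSet.ncard = 3 * n - 6

/-- `M` is a matching of size `k` in `G` (a copy of `kK₂`): a set of `k` pairwise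
vertex-disjoint edges of `G`. -/
def IsMatchingOfSize {V : Type*} (G : SimpleGraph V) (M : Finset (Sym2 V)) (k : ℕ) : Prop :=
  M.card = k ∧ (↑M : Set (Sym2 V)) ⊆ G.edgeSet ∧
    ∀ e ∈ M, ∀ e' ∈ M, e ≠ e' → ∀ v : V, v ∈ e → v ∉ e'

/-- Under the edge-coloring `c`, the graph `G` contains a rainbow matching of size `k`. -/
def HasRainbowMatching {V α : Type*} (G : SimpleGraph V) (c : Sym2 V → α) (k : ℕ) : Prop :=
  ∃ M : Finset (Sym2 V), IsMatchingOfSize G M k ∧ Set.InjOn c (↑M : Set (Sym2 V))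

/-- `r` colors suffice for rainbow `kK₂` in every plane triangulation on `n` vertices:
every edge-coloring of such a triangulation using at least `r` distinct colors contains
a rainbow matching of size `k`. -/
def RainbowThreshold (n k r : ℕ) : Prop :=
  ∀ G : SimpleGraph (Fin n), IsPlaneTriangulation G →
    ∀ c : Sym2 (Fin n) → ℕ, r ≤ (c '' G.edgeSet).ncard → HasRainbowMatching G c k

/-- The number of odd components (connected components with an odd number of vertices)
of a graph. -/
noncomputable def oddComponentCount {V : Type*} (G : SimpleGraph V) : ℕ :=
  Set.ncard {C : G.ConnectedComponent | Odd C.supp.ncard}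

/-! ### Lifts of the difference of two curves through the exponential -/

theorem exists_log_lift (γ γ' : ℝ → ℂ) (h : Continuous γ) (h' : Continuous γ')
    (hne : ∀ s t, γ s ≠ γ' t) :
    ∃ L : ℝ × ℝ → ℂ, Continuous L ∧ ∀ s t, Complex.exp (L (s, t)) = γ s - γ' t := by
  let F : C(ℝ × ℝ, ℂ) := ⟨fun q => γ q.1 - γ' q.2, by fun_prop⟩
  have hs : ∀ a, F a ∈ ({0}ᶜ : Set ℂ) := fun a => sub_ne_zero.2 (hne _ _)
  obtain ⟨L, ⟨-, hL⟩, -⟩ := Complex.isCoveringMapOn_exp.existsUnique_continuousMap_lifts F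
    (a₀ := (0, 0)) (e₀ := Complex.log (F (0, 0))) (Complex.exp_log (hs _)) hs
  exact ⟨L, L.continuous, fun s t => congrFun hL (s, t)⟩

theorem lift_diff_eq (L L' : ℝ → ℂ) (h : Continuous L) (h' : Continuous L')
    (he : ∀ t, Complex.exp (L t) = Complex.exp (L' t)) : L 1 - L 0 = L' 1 - L' 0 := by
  have key : L = fun t => L' t + (L 0 - L' 0) := by
    refine Complex.isCoveringMap_exp.eq_of_comp_eq h (by fun_prop) ?_ 0 (by ring)
    funext t
    apply Subtype.ext
    simp only [Function.comp]
    rw [Complex.exp_add, Complex.exp_sub, he 0, div_self (Complex.exp_ne_zero _), mul_one, he]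
  have := congrFun key 1
  rw [this]; ring

theorem lift_square (γ γ' : ℝ → ℂ) (h : Continuous γ) (h' : Continuous γ')
    (hne : ∀ s t, γ s ≠ γ' t) (La Lb Lc Ld : ℝ → ℂ)
    (ca : Continuous La) (cb : Continuous Lb) (cc : Continuous Lc) (cd : Continuous Ld)
    (ha : ∀ t, Complex.exp (La t) = γ' t - γ 0) (hb : ∀ t, Complex.exp (Lb t) = γ' t - γ 1)
    (hc : ∀ t, Complex.exp (Lc t) = γ t - γ' 0) (hd : ∀ t, Complex.exp (Ld t) = γ t - γ' 1) :
    (Lc 1 - Lc 0) - (Ld 1 - Ld 0) + (Lb 1 - Lb 0) - (La 1 - La 0) = 0 := by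
  obtain ⟨L, cL, hL⟩ := exists_log_lift γ γ' h h' hne
  have e1 := lift_diff_eq Lc (fun s => L (s, 0)) cc (by fun_prop) (fun t => by rw [hc, hL])
  have e2 := lift_diff_eq Ld (fun s => L (s, 1)) cd (by fun_prop) (fun t => by rw [hd, hL])
  have e3 := lift_diff_eq La (fun s => L (0, s) + Real.pi * Complex.I) ca (by fun_prop)
    (fun t => by rw [ha, Complex.exp_add, hL, Complex.exp_pi_mul_I]; ring)
  have e4 := lift_diff_eq Lb (fun s => L (1, s) + Real.pi * Complex.I) cb (by fun_prop)
    (fun t => by rw [hb, Complex.exp_add, hL, Complex.exp_pi_mul_I]; ring)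
  rw [e1, e2, e3, e4]; ring

/-! ### Weak drawings: independent edges have disjoint images -/

/-- A weak drawing of `G`: the edges are curves, and the curves of two vertex-disjoint edges
are disjoint. -/
def WeaklyDrawable {V : Type*} (G : SimpleGraph V) : Prop :=
  ∃ (f : V → ℂ) (K : V → V → Set ℂ),
    (∀ a b, G.Adj a b → JoinedIn (K a b) (f a) (f b)) ∧
    ∀ a b c d, G.Adj a b → G.Adj c d → a ≠ c → a ≠ d → b ≠ c → b ≠ d →
      Disjoint (K a b) (K c d)

theorem WeaklyDrawable.mono {V : Type*} {G H : SimpleGraph V} (hG : WeaklyDrawable G)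
    (h : H ≤ G) : WeaklyDrawable H := by
  obtain ⟨f, K, h1, h2⟩ := hG
  exact ⟨f, K, fun a b hab => h1 a b (h hab),
    fun a b c d hab hcd => h2 a b c d (h hab) (h hcd)⟩

theorem WeaklyDrawable.of_isPlanar {V : Type*} {G : SimpleGraph V} (hG : G.IsPlanar) :
    WeaklyDrawable G := by
  classical
  obtain ⟨f, γ, hf, hc, hi, he, hv, hd⟩ := hG
  let φ : ℝ × ℝ → ℂ := Complex.equivRealProdCLM.symm
  have hφ : Function.Injective φ := Complex.equivRealProdCLM.symm.injective
  have hφc : Continuous φ := Complex.equivRealProdCLM.symm.continuous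
  refine ⟨fun v => φ (f v), fun a b => if h : G.Adj a b then
    φ '' (γ ⟨s(a, b), h⟩ '' Set.Icc 0 1) else ∅, ?_, ?_⟩
  · intro a b hab
    simp only [hab, dif_pos]
    obtain ⟨u, v, huv, h0, h1⟩ := he ⟨s(a, b), hab⟩
    have hJ : JoinedIn (γ ⟨s(a, b), hab⟩ '' Set.Icc 0 1) (f u) (f v) :=
      JoinedIn.ofLine (hc _) h0 h1 subset_rfl
    have hJ' := hJ.map hφc
    rcases Sym2.eq_iff.1 huv with ⟨rfl, rfl⟩ | ⟨rfl, rfl⟩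
    · exact hJ'
    · exact hJ'.symm
  · intro a b c d hab hcd h1 h2 h3 h4
    simp only [hab, hcd, dif_pos]
    refine (Set.disjoint_image_iff hφ).2 ?_
    rw [Set.disjoint_left]
    rintro _ ⟨s, hs, rfl⟩ ⟨t, ht, hst⟩
    have hne : (⟨s(a, b), hab⟩ : G.edgeSet) ≠ ⟨s(c, d), hcd⟩ := by
      intro h
      rcases Sym2.eq_iff.1 (congrArg Subtype.val h) with ⟨h, -⟩ | ⟨h, -⟩
      exacts [h1 h, h2 h]
    have ends : ∀ (x y : V) (hxy : G.Adj x y) (r : ℝ), r ∈ Set.Icc (0:ℝ) 1 →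
        r ∈ Set.Ioo (0:ℝ) 1 ∨ γ ⟨s(x, y), hxy⟩ r = f x ∨ γ ⟨s(x, y), hxy⟩ r = f y := by
      intro x y hxy r hr
      obtain ⟨u, v, huv, h0, h1⟩ := he ⟨s(x, y), hxy⟩
      rcases eq_or_lt_of_le hr.1 with rfl | hr0
      · right
        rcases Sym2.eq_iff.1 huv with ⟨rfl, rfl⟩ | ⟨rfl, rfl⟩ <;> simp [h0]
      rcases eq_or_lt_of_le hr.2 with rfl | hr1
      · right
        rcases Sym2.eq_iff.1 huv with ⟨rfl, rfl⟩ | ⟨rfl, rfl⟩ <;> simp [h1]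
      exact Or.inl ⟨hr0, hr1⟩
    rcases ends a b hab s hs with h | h | h <;> rcases ends c d hcd t ht with h' | h' | h'
    · exact hd _ _ hne s h t h' hst.symm
    · exact hv _ s h c (hst.symm.trans h')
    · exact hv _ s h d (hst.symm.trans h')
    · exact hv _ t h' a (hst.trans h)
    · exact h1 (hf (h.symm.trans (hst.symm.trans h')))
    · exact h2 (hf (h.symm.trans (hst.symm.trans h')))
    · exact hv _ t h' b (hst.trans h)
    · exact h3 (hf (h.symm.trans (hst.symm.trans h')))
    · have hfbd : f b = f d := h.symm.trans (hst.symm.trans h')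
      exact h4 (hf hfbd)

/-- `K₅` has no weak drawing. -/
theorem WeaklyDrawable.no_K5 {V : Type*} {G : SimpleGraph V} (hG : WeaklyDrawable G)
    (g : Fin 5 → V) (hg : ∀ i j, i ≠ j → G.Adj (g i) (g j)) : False := by
  obtain ⟨f', K', h1, h2⟩ := hG
  have hgne : ∀ i j, i ≠ j → g i ≠ g j := fun i j h => (hg i j h).ne
  let f : Fin 5 → ℂ := fun i => f' (g i)
  have hP : ∀ i j, i ≠ j → ∃ P : ℝ → ℂ, Continuous P ∧ P 0 = f i ∧ P 1 = f j ∧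
      ∀ t, P t ∈ K' (g i) (g j) := by
    intro i j hij
    have hJ := h1 _ _ (hg i j hij)
    exact ⟨hJ.somePath.extend, hJ.somePath.continuous_extend, by simp [f], by simp [f],
      fun t => hJ.somePath_mem _⟩
  choose! P Pc P0 P1 PK using hP
  have hdis : ∀ a b c d, a ≠ b → c ≠ d → a ≠ c → a ≠ d → b ≠ c → b ≠ d →
      ∀ s t, P a b s ≠ P c d t := by
    intro a b c d hab hcd hac had hbc hbd s t hst
    refine Set.disjoint_left.1 (h2 _ _ _ _ (hg a b hab) (hg c d hcd) (hgne _ _ hac) (hgne _ _ had)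
      (hgne _ _ hbc) (hgne _ _ hbd)) (PK a b hab s) ?_
    rw [hst]; exact PK c d hcd t
  have hpt : ∀ a b c, a ≠ b → a ≠ c → b ≠ c → ∀ s, P a b s ≠ f c := by
    intro a b c hab hac hbc s
    obtain ⟨d, hd⟩ : ∃ d : Fin 5, d ≠ a ∧ d ≠ b ∧ d ≠ c := by
      revert a b c; decide
    rw [← P0 c d hd.2.2.symm]
    exact hdis a b c d hab hd.2.2.symm hac hd.1.symm hbc hd.2.1.symm s 0
  have hf : ∀ a c, a ≠ c → f a ≠ f c := by
    intro a c hac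
    obtain ⟨b, hb⟩ : ∃ b : Fin 5, b ≠ a ∧ b ≠ c := by
      revert a c; decide
    rw [← P0 a b hb.1.symm]
    exact hpt a b c hb.1.symm hac hb.2 0
  have hL : ∀ c a b, a ≠ b → a ≠ c → b ≠ c → ∃ L : ℝ → ℂ, Continuous L ∧
      ∀ t, Complex.exp (L t) = P a b t - f c := by
    intro c a b hab hac hbc
    obtain ⟨L, cL, hL⟩ := exists_log_lift (P a b) (fun _ => f c) (Pc a b hab) continuous_const
      (fun s _ => hpt a b c hab hac hbc s)
    exact ⟨fun s => L (s, 0), by fun_prop, fun t => hL t 0⟩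
  choose! L Lc hL using hL
  obtain ⟨l, hl1, hl2⟩ : ∃ l : Fin 5 → Fin 5 → ℂ, (∀ x y, x ≠ y → Complex.exp (l x y) = f y - f x) ∧
      ∀ x y, x ≠ y → l y x - l x y = Real.pi * Complex.I * ((if x < y then 1 else -1 : ℤ) : ℂ) := by
    refine ⟨fun x y => if x < y then Complex.log (f y - f x)
      else Complex.log (f x - f y) + Real.pi * Complex.I, ?_, ?_⟩
    · intro x y hxy
      by_cases h : x < y
      · simp only [h, if_true]; exact Complex.exp_log (sub_ne_zero.2 (hf _ _ hxy.symm))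
      · simp only [h, if_false]
        rw [Complex.exp_add, Complex.exp_log (sub_ne_zero.2 (hf _ _ hxy)), Complex.exp_pi_mul_I]
        ring
    · intro x y hxy
      rcases lt_or_gt_of_ne hxy with h | h
      · simp [h, h.not_gt]
      · simp [h, h.not_gt]
  have hm : ∀ c a b, a ≠ b → a ≠ c → b ≠ c → ∃ m : ℤ,
      L c a b 1 - L c a b 0 = l c b - l c a + m * (2 * Real.pi * Complex.I) := by
    intro c a b hab hac hbc
    apply Complex.exp_eq_exp_iff_exists_int.1
    rw [Complex.exp_sub, Complex.exp_sub, hL c a b hab hac hbc, hL c a b hab hac hbc,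
      P0 a b hab, P1 a b hab, hl1 _ _ hbc.symm, hl1 _ _ hac.symm]
  choose! m hm using hm
  have key : ∀ a b c d : Fin 5, a ≠ b → c ≠ d → a ≠ c → a ≠ d → b ≠ c → b ≠ d →
      (if b < c then 1 else -1 : ℤ) + (if c < a then 1 else -1 : ℤ) +
      (if a < d then 1 else -1 : ℤ) + (if d < b then 1 else -1 : ℤ) +
      2 * (m c a b - m d a b + m b c d - m a c d) = 0 := by
    intro a b c d hab hcd hac had hbc hbd
    have hsq := lift_square (P a b) (P c d) (Pc a b hab) (Pc c d hcd)
      (hdis a b c d hab hcd hac had hbc hbd) (L a c d) (L b c d) (L c a b) (L d a b)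
      (Lc _ _ _ hcd hac.symm had.symm) (Lc _ _ _ hcd hbc.symm hbd.symm)
      (Lc _ _ _ hab hac hbc) (Lc _ _ _ hab had hbd)
      (by rw [P0 a b hab]; exact hL _ _ _ hcd hac.symm had.symm)
      (by rw [P1 a b hab]; exact hL _ _ _ hcd hbc.symm hbd.symm)
      (by rw [P0 c d hcd]; exact hL _ _ _ hab hac hbc)
      (by rw [P1 c d hcd]; exact hL _ _ _ hab had hbd)
    rw [hm _ _ _ hcd hac.symm had.symm, hm _ _ _ hcd hbc.symm hbd.symm, hm _ _ _ hab hac hbc,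
      hm _ _ _ hab had hbd] at hsq
    have e1 := hl2 b c hbc
    have e2 := hl2 c a hac.symm
    have e3 := hl2 a d had
    have e4 := hl2 d b hbd.symm
    have hpi : (Real.pi * Complex.I : ℂ) ≠ 0 :=
      mul_ne_zero (by exact_mod_cast Real.pi_ne_zero) Complex.I_ne_zero
    have hz : (Real.pi * Complex.I : ℂ) * (((if b < c then 1 else -1 : ℤ) +
      (if c < a then 1 else -1 : ℤ) +
      (if a < d then 1 else -1 : ℤ) + (if d < b then 1 else -1 : ℤ) +
      2 * (m c a b - m d a b + m b c d - m a c d) : ℤ) : ℂ) = 0 := by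
      simp only [Int.cast_add, Int.cast_mul, Int.cast_sub, Int.cast_ofNat]
      linear_combination hsq - e1 - e2 - e3 - e4
    exact_mod_cast (mul_eq_zero.1 hz).resolve_left hpi
  have k1 := key 0 1 2 3 (by decide) (by decide) (by decide) (by decide) (by decide) (by decide)
  have k2 := key 0 1 2 4 (by decide) (by decide) (by decide) (by decide) (by decide) (by decide)
  have k3 := key 0 1 3 4 (by decide) (by decide) (by decide) (by decide) (by decide) (by decide)
  have k4 := key 0 2 1 3 (by decide) (by decide) (by decide) (by decide) (by decide) (by decide)
  have k5 := key 0 2 1 4 (by decide) (by decide) (by decide) (by decide) (by decide) (by decide)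
  have k6 := key 0 2 3 4 (by decide) (by decide) (by decide) (by decide) (by decide) (by decide)
  have k7 := key 0 3 1 2 (by decide) (by decide) (by decide) (by decide) (by decide) (by decide)
  have k8 := key 0 3 1 4 (by decide) (by decide) (by decide) (by decide) (by decide) (by decide)
  have k9 := key 0 3 2 4 (by decide) (by decide) (by decide) (by decide) (by decide) (by decide)
  have k10 := key 0 4 1 2 (by decide) (by decide) (by decide) (by decide) (by decide) (by decide)
  have k11 := key 0 4 1 3 (by decide) (by decide) (by decide) (by decide) (by decide) (by decide)
  have k12 := key 0 4 2 3 (by decide) (by decide) (by decide) (by decide) (by decide) (by decide)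
  have k13 := key 1 2 3 4 (by decide) (by decide) (by decide) (by decide) (by decide) (by decide)
  have k14 := key 1 3 2 4 (by decide) (by decide) (by decide) (by decide) (by decide) (by decide)
  have k15 := key 1 4 2 3 (by decide) (by decide) (by decide) (by decide) (by decide) (by decide)
  simp [Fin.lt_def] at k1 k2 k3 k4 k5 k6 k7 k8 k9 k10 k11 k12 k13 k14 k15
  omega

theorem WeaklyDrawable.no_K5' {V : Type*} {G : SimpleGraph V} (hG : WeaklyDrawable G)
    (a b c d e : V) (hab : G.Adj a b) (hac : G.Adj a c) (had : G.Adj a d) (hae : G.Adj a e)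
    (hbc : G.Adj b c) (hbd : G.Adj b d) (hbe : G.Adj b e) (hcd : G.Adj c d) (hce : G.Adj c e)
    (hde : G.Adj d e) : False := by
  refine hG.no_K5 ![a, b, c, d, e] ?_
  intro i j hij
  fin_cases i <;> fin_cases j <;> first | exact absurd rfl hij | assumption | skip
  all_goals (apply SimpleGraph.Adj.symm; assumption)

/-! ### Contracting an edge -/

/-- Contract `v` into `u`; the vertex `v` becomes isolated. -/
def contractInto {V : Type*} (G : SimpleGraph V) (u v : V) : SimpleGraph V where
  Adj x y := x ≠ y ∧ x ≠ v ∧ y ≠ v ∧ (G.Adj x y ∨ (x = u ∧ G.Adj v y) ∨ (y = u ∧ G.Adj v x))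
  symm := ⟨fun x y ⟨h1, h2, h3, h4⟩ => ⟨h1.symm, h3, h2, by
    rcases h4 with h | h | h
    · exact Or.inl h.symm
    · exact Or.inr (Or.inr h)
    · exact Or.inr (Or.inl h)⟩⟩
  loopless := ⟨fun x h => h.1 rfl⟩

theorem WeaklyDrawable.contractInto {V : Type*} {G : SimpleGraph V} (hG : WeaklyDrawable G)
    {u v : V} (huv : G.Adj u v) : WeaklyDrawable (contractInto G u v) := by
  classical
  obtain ⟨f, K, h1, h2⟩ := hG
  refine ⟨f, fun x y => if G.Adj x y then K x y else if x = u then K u v ∪ K v y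
    else K x v ∪ K v u, ?_, ?_⟩
  · rintro x y ⟨hxy, hxv, hyv, h⟩
    by_cases hA : G.Adj x y
    · simp only [hA, if_true]; exact h1 _ _ hA
    by_cases hx : x = u
    · subst hx
      have hvy : G.Adj v y := by
        rcases h with h | h | h
        · exact absurd h hA
        · exact h.2
        · exact absurd h.1.symm hxy
      simp only [hA, if_true, if_false]
      exact ((h1 _ _ huv).mono Set.subset_union_left).trans
        ((h1 _ _ hvy).mono Set.subset_union_right)
    · have hvy : y = u ∧ G.Adj v x := by
        rcases h with h | h | h
        · exact absurd h hA
        · exact absurd h.1 hx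
        · exact h
      obtain ⟨rfl, hvx⟩ := hvy
      simp only [hA, hx, if_false]
      exact ((h1 _ _ hvx.symm).mono Set.subset_union_left).trans
        ((h1 _ _ huv.symm).mono Set.subset_union_right)
  · rintro a b c d ⟨hab, hav, hbv, h⟩ ⟨hcd, hcv, hdv, h'⟩ hac had hbc hbd
    have hvu := huv.symm
    by_cases hA : G.Adj a b <;> by_cases hB : G.Adj c d
    · simp only [hA, hB, if_true]
      exact h2 _ _ _ _ hA hB hac had hbc hbd
    · simp only [hA, hB, if_true, if_false]
      rcases h' with h' | ⟨rfl, h'⟩ | ⟨rfl, h'⟩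
      · exact absurd h' hB
      · simp only [if_true, Set.disjoint_union_right]
        exact ⟨h2 _ _ _ _ hA huv hac hav hbc hbv, h2 _ _ _ _ hA h' hav had hbv hbd⟩
      · simp only [hcd, if_false, Set.disjoint_union_right]
        exact ⟨h2 _ _ _ _ hA h'.symm hac hav hbc hbv, h2 _ _ _ _ hA hvu hav had hbv hbd⟩
    · simp only [hA, hB, if_true, if_false]
      rcases h with h | ⟨rfl, h⟩ | ⟨rfl, h⟩
      · exact absurd h hA
      · simp only [if_true, Set.disjoint_union_left]
        exact ⟨h2 _ _ _ _ huv hB hac had hcv.symm hdv.symm,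
          h2 _ _ _ _ h hB hcv.symm hdv.symm hbc hbd⟩
      · simp only [hab, if_false, Set.disjoint_union_left]
        exact ⟨h2 _ _ _ _ h.symm hB hac had hcv.symm hdv.symm,
          h2 _ _ _ _ hvu hB hcv.symm hdv.symm hbc hbd⟩
    · exfalso
      rcases h with h | ⟨h, -⟩ | ⟨h, -⟩
      · exact hA h
      all_goals
        rcases h' with h' | ⟨h', -⟩ | ⟨h', -⟩
        · exact hB h'
        all_goals subst h'; subst h; simp at *

theorem ncard_edgeSet_eq {V : Type*} (G : SimpleGraph V) [Fintype G.edgeSet] :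
    G.edgeSet.ncard = G.edgeFinset.card := by
  rw [← SimpleGraph.coe_edgeFinset, Set.ncard_coe_finset]

open Classical in
theorem edges_contractInto {V : Type*} [Fintype V] (G : SimpleGraph V) {u v : V}
    (huv : G.Adj u v) :
    G.edgeSet.ncard ≤ (contractInto G u v).edgeSet.ncard + 1 +
      (G.neighborFinset u ∩ G.neighborFinset v).card := by
  rw [ncard_edgeSet_eq, ncard_edgeSet_eq]
  set E0 := G.edgeFinset.filter (fun e => v ∉ e) with hE0
  set N' := ((G.neighborFinset v) \ (G.neighborFinset u)).erase u with hN'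
  set E1 := N'.image (fun x => s(u, x)) with hE1
  have c1 : G.edgeFinset.card ≤ E0.card + G.degree v := by
    rw [← G.card_incidenceFinset_eq_degree v]
    refine (Finset.card_le_card ?_).trans (Finset.card_union_le _ _)
    intro e he
    by_cases hv : v ∈ e
    · refine Finset.mem_union_right _ ?_
      rw [SimpleGraph.mem_incidenceFinset]
      exact ⟨SimpleGraph.mem_edgeFinset.1 he, hv⟩
    · exact Finset.mem_union_left _ (Finset.mem_filter.2 ⟨he, hv⟩)
  have c2 : E1.card = N'.card := by
    refine Finset.card_image_of_injective _ ?_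
    intro x y hxy
    exact Sym2.congr_right.1 hxy
  have c3 : G.degree v ≤ N'.card + 1 + (G.neighborFinset u ∩ G.neighborFinset v).card := by
    have a1 := Finset.card_sdiff_add_card_inter (G.neighborFinset v) (G.neighborFinset u)
    have a2 : ((G.neighborFinset v) \ (G.neighborFinset u)).card - 1 ≤ N'.card :=
      Finset.pred_card_le_card_erase
    rw [Finset.inter_comm, ← G.card_neighborFinset_eq_degree]
    omega
  have c4 : E0.card + E1.card ≤ (contractInto G u v).edgeFinset.card := by
    rw [← Finset.card_union_of_disjoint]
    · apply Finset.card_le_card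
      intro e he
      rw [SimpleGraph.mem_edgeFinset]
      rcases Finset.mem_union.1 he with he | he
      · obtain ⟨h1, h2⟩ := Finset.mem_filter.1 he
        rw [SimpleGraph.mem_edgeFinset] at h1
        induction e with | _ x y =>
        simp only [Sym2.mem_iff, not_or] at h2
        exact ⟨h1.ne, Ne.symm h2.1, Ne.symm h2.2, Or.inl h1⟩
      · obtain ⟨x, hx, rfl⟩ := Finset.mem_image.1 he
        simp only [hN', Finset.mem_erase, Finset.mem_sdiff, SimpleGraph.mem_neighborFinset] at hx
        exact ⟨hx.1.symm, huv.ne, hx.2.1.ne.symm, Or.inr (Or.inl ⟨rfl, hx.2.1⟩)⟩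
    · rw [Finset.disjoint_left]
      intro e he he'
      obtain ⟨h1, h2⟩ := Finset.mem_filter.1 he
      obtain ⟨x, hx, rfl⟩ := Finset.mem_image.1 he'
      simp only [hN', Finset.mem_erase, Finset.mem_sdiff, SimpleGraph.mem_neighborFinset] at hx
      exact hx.2.2 (SimpleGraph.mem_edgeFinset.1 h1)
  omega

theorem edges_le_choose {V : Type*} [Fintype V] (G : SimpleGraph V) (A : Finset V)
    (hA : ∀ x y, G.Adj x y → x ∈ A) : G.edgeSet.ncard ≤ A.card.choose 2 := by
  classical
  rw [ncard_edgeSet_eq, ← Sym2.card_image_offDiag]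
  apply Finset.card_le_card
  intro e he
  rw [SimpleGraph.mem_edgeFinset] at he
  induction e with | _ x y =>
  exact Finset.mem_image.2 ⟨(x, y), Finset.mem_offDiag.2 ⟨hA x y he, hA y x he.symm, he.ne⟩, rfl⟩

/-- The octahedron-like configuration `K₂ + C₄` is not weakly drawable. -/
theorem WeaklyDrawable.no_wheel {V : Type*} {G : SimpleGraph V} (hG : WeaklyDrawable G)
    (v x c c' y z : V) (hcc : c ≠ c') (hvx : G.Adj v x) (hvc : G.Adj v c) (hvc' : G.Adj v c')
    (hvy : G.Adj v y) (hvz : G.Adj v z) (hxy : G.Adj x y) (hxz : G.Adj x z) (hxc : G.Adj x c)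
    (hxc' : G.Adj x c') (hcy : G.Adj c y) (hcz : G.Adj c z) (hcy' : G.Adj c' y)
    (hcz' : G.Adj c' z) (hyz : y ≠ z) : False := by
  have hC := hG.contractInto hcy
  have mk : ∀ p q, G.Adj p q → p ≠ y → q ≠ y → (_root_.contractInto G c y).Adj p q :=
    fun p q h h1 h2 => ⟨h.ne, h1, h2, Or.inl h⟩
  refine hC.no_K5' v x c c' z (mk _ _ hvx hvy.ne hxy.ne) (mk _ _ hvc hvy.ne hcy.ne)
    (mk _ _ hvc' hvy.ne hcy'.ne) (mk _ _ hvz hvy.ne hyz.symm) (mk _ _ hxc hxy.ne hcy.ne)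
    (mk _ _ hxc' hxy.ne hcy'.ne) (mk _ _ hxz hxy.ne hyz.symm)
    ⟨hcc, hcy.ne, hcy'.ne, Or.inr (Or.inl ⟨rfl, hcy'.symm⟩)⟩
    (mk _ _ hcz hcy.ne hyz.symm) (mk _ _ hcz' hcy'.ne hyz.symm)

open Classical in
theorem WeaklyDrawable.local_config {V : Type*} [Fintype V] {G : SimpleGraph V}
    (hG : WeaklyDrawable G) (v : V) (h0 : 0 < (G.neighborFinset v).card)
    (h5 : (G.neighborFinset v).card ≤ 5)
    (h3 : ∀ x, G.Adj v x → 3 ≤ (G.neighborFinset x ∩ G.neighborFinset v).card) : False := by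
  set N := G.neighborFinset v with hN
  have hmem : ∀ x, x ∈ N ↔ G.Adj v x := fun x => by simp [hN]
  have h4 : 4 ≤ N.card := by
    obtain ⟨x, hx⟩ := Finset.card_pos.1 h0
    have := h3 x ((hmem x).1 hx)
    have hsub : G.neighborFinset x ∩ N ⊆ N.erase x := by
      intro y hy
      rw [Finset.mem_inter, SimpleGraph.mem_neighborFinset] at hy
      exact Finset.mem_erase.2 ⟨hy.1.ne.symm, hy.2⟩
    have h' := Finset.card_le_card hsub
    rw [Finset.card_erase_of_mem hx] at h'
    omega
  have miss : ∀ p q r, p ∈ N → q ∈ N → r ∈ N → p ≠ q → p ≠ r → q ≠ r → ¬ G.Adj p q →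
      G.Adj p r := by
    intro p q r hp hq hr hpq hpr hqr hn
    by_contra hn'
    have := h3 p ((hmem p).1 hp)
    have hsub : G.neighborFinset p ∩ N ⊆ ((N.erase p).erase q).erase r := by
      intro y hy
      rw [Finset.mem_inter, SimpleGraph.mem_neighborFinset] at hy
      simp only [Finset.mem_erase]
      refine ⟨?_, ?_, hy.1.ne.symm, hy.2⟩
      · rintro rfl; exact hn' hy.1
      · rintro rfl; exact hn hy.1
    have h' := Finset.card_le_card hsub
    rw [Finset.card_erase_of_mem (by simp [hr, hpr.symm, hqr.symm]),
      Finset.card_erase_of_mem (by simp [hq, hpq.symm]), Finset.card_erase_of_mem hp] at h'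
    omega
  by_cases hall : ∀ p ∈ N, ∀ q ∈ N, p ≠ q → G.Adj p q
  · obtain ⟨T, hT, hT4⟩ := Finset.exists_subset_card_eq h4
    obtain ⟨a, T', haT, rfl, hT3⟩ := Finset.card_eq_succ.1 hT4
    obtain ⟨b, c, d, hbc, hbd, hcd, rfl⟩ := Finset.card_eq_three.1 hT3
    have ha : a ∈ N := hT (by simp)
    have hb : b ∈ N := hT (by simp)
    have hc : c ∈ N := hT (by simp)
    have hd : d ∈ N := hT (by simp)
    simp only [Finset.mem_insert, Finset.mem_singleton, not_or] at haT
    exact hG.no_K5' v a b c d ((hmem _).1 ha) ((hmem _).1 hb) ((hmem _).1 hc) ((hmem _).1 hd)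
      (hall _ ha _ hb haT.1) (hall _ ha _ hc haT.2.1) (hall _ ha _ hd haT.2.2)
      (hall _ hb _ hc hbc) (hall _ hb _ hd hbd) (hall _ hc _ hd hcd)
  · push Not at hall
    obtain ⟨c, hc, c', hc', hcc, hn⟩ := hall
    have hn' : ¬ G.Adj c' c := fun h => hn h.symm
    have hR : 3 ≤ ((N.erase c).erase c').card := by
      have := h3 c ((hmem c).1 hc)
      refine this.trans (Finset.card_le_card ?_)
      intro y hy
      rw [Finset.mem_inter, SimpleGraph.mem_neighborFinset] at hy
      simp only [Finset.mem_erase]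
      refine ⟨?_, hy.1.ne.symm, hy.2⟩
      rintro rfl; exact hn hy.1
    obtain ⟨T, hT, hT3⟩ := Finset.exists_subset_card_eq hR
    obtain ⟨x, y, z, hxy, hxz, hyz, rfl⟩ := Finset.card_eq_three.1 hT3
    have hx := hT (show x ∈ ({x, y, z} : Finset V) by simp)
    have hy := hT (show y ∈ ({x, y, z} : Finset V) by simp)
    have hz := hT (show z ∈ ({x, y, z} : Finset V) by simp)
    simp only [Finset.mem_erase] at hx hy hz
    have ad : ∀ w, w ≠ c' ∧ w ≠ c ∧ w ∈ N → G.Adj c w ∧ G.Adj c' w := fun w hw =>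
      ⟨miss c c' w hc hc' hw.2.2 hcc hw.2.1.symm hw.1.symm hn,
        miss c' c w hc' hc hw.2.2 hcc.symm hw.1.symm hw.2.1.symm hn'⟩
    have fin : ∀ x y z, (x ≠ c' ∧ x ≠ c ∧ x ∈ N) → (y ≠ c' ∧ y ≠ c ∧ y ∈ N) →
        (z ≠ c' ∧ z ≠ c ∧ z ∈ N) → G.Adj x y → G.Adj x z → y ≠ z → False := by
      intro x y z hx hy hz hxy hxz hyz
      exact hG.no_wheel v x c c' y z hcc ((hmem _).1 hx.2.2) ((hmem _).1 hc) ((hmem _).1 hc')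
        ((hmem _).1 hy.2.2) ((hmem _).1 hz.2.2) hxy hxz (ad x hx).1.symm (ad x hx).2.symm
        (ad y hy).1 (ad z hz).1 (ad y hy).2 (ad z hz).2 hyz
    by_cases h1 : G.Adj x y
    · by_cases h2 : G.Adj x z
      · exact fin x y z hx hy hz h1 h2 hyz
      · exact fin y x z hy hx hz h1.symm (miss z x y hz.2.2 hx.2.2 hy.2.2 hxz.symm hyz.symm hxy
          (fun h => h2 h.symm)).symm hxz
    · exact fin z x y hz hx hy (miss x y z hx.2.2 hy.2.2 hz.2.2 hxy hxz hyz h1).symm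
        (miss y x z hy.2.2 hx.2.2 hz.2.2 hxy.symm hyz hxz (fun h => h1 h.symm)).symm hxy

/-- Euler bound: a weakly drawable graph supported on `m ≥ 3` vertices has at most `3m-6` edges. -/
theorem WeaklyDrawable.edge_bound {V : Type*} [Fintype V] (m : ℕ) (hm : 3 ≤ m) :
    ∀ (A : Finset V) (G : SimpleGraph V), A.card = m → (∀ x y, G.Adj x y → x ∈ A) →
      WeaklyDrawable G → G.edgeSet.ncard ≤ 3 * m - 6 := by
  classical
  induction m, hm using Nat.le_induction with
  | base =>
    intro A G hA hsupp _
    have := edges_le_choose G A hsupp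
    rw [hA] at this
    simpa [Nat.choose] using this
  | succ m hm ih =>
    intro A G₀ hA hsupp₀ hG₀
    by_contra hlt
    push Not at hlt
    have hle : 3 * m - 2 ≤ G₀.edgeFinset.card := by
      rw [← ncard_edgeSet_eq]; omega
    obtain ⟨T, hT, hTc⟩ := Finset.exists_subset_card_eq hle
    have hTE : (T : Set (Sym2 V)) ⊆ G₀.edgeSet := fun e he => SimpleGraph.mem_edgeFinset.1 (hT he)
    obtain ⟨G, hG0, hGe⟩ : ∃ G : SimpleGraph V, G ≤ G₀ ∧ G.edgeSet.ncard = 3 * m - 2 := by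
      refine ⟨SimpleGraph.fromEdgeSet T, ?_, ?_⟩
      · intro x y hxy
        exact hTE ((SimpleGraph.fromEdgeSet_adj _).1 hxy).1
      · rw [SimpleGraph.edgeSet_fromEdgeSet, ← hTc, ← Set.ncard_coe_finset]
        congr 1
        ext e
        simp only [Set.mem_sdiff]
        exact ⟨fun h => h.1, fun h => ⟨h, fun hd => G₀.not_isDiag_of_mem_edgeSet (hTE h) hd⟩⟩
    have hG := hG₀.mono hG0
    have hsupp : ∀ x y, G.Adj x y → x ∈ A := fun x y h => hsupp₀ x y (hG0 h)
    obtain ⟨v, hvA, hv5⟩ : ∃ v ∈ A, G.degree v ≤ 5 := by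
      by_contra hcon
      push Not at hcon
      have hs := G.sum_degrees_eq_twice_card_edges
      rw [← ncard_edgeSet_eq, hGe] at hs
      have h1 : ∑ v ∈ A, 6 ≤ ∑ v ∈ A, G.degree v := Finset.sum_le_sum fun v hv => hcon v hv
      have h2 : ∑ v ∈ A, G.degree v ≤ ∑ v, G.degree v :=
        Finset.sum_le_sum_of_subset (Finset.subset_univ _)
      rw [Finset.sum_const, hA, smul_eq_mul] at h1
      omega
    have hAe : (A.erase v).card = m := by rw [Finset.card_erase_of_mem hvA, hA]; omega
    rcases Nat.eq_zero_or_pos (G.degree v) with hz | hpos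
    · have := ih (A.erase v) G hAe (fun x y h => Finset.mem_erase.2 ⟨?_, hsupp x y h⟩) hG
      · omega
      · rintro rfl
        exact (G.degree_pos_iff_exists_adj _).2 ⟨y, h⟩ |>.ne' hz
    · refine hG.local_config v hpos hv5 ?_
      intro x hvx
      have h1 := edges_contractInto G hvx.symm
      have h2 := ih (A.erase v) (_root_.contractInto G x v) hAe (fun p q h => ?_)
        (hG.contractInto hvx.symm)
      · omega
      · refine Finset.mem_erase.2 ⟨h.2.1, ?_⟩
        rcases h.2.2.2 with h' | ⟨rfl, h'⟩ | ⟨rfl, h'⟩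
        · exact hsupp _ _ h'
        · exact hsupp _ _ hvx.symm
        · have hpv : G.Adj p v := h'.symm
          exact hsupp _ _ hpv

/-- Let `G` be a planar simple graph on `n ≥ 11` vertices whose maximum matching has
size 4, and suppose there is `S ⊆ V(G)` with `|S| ≤ 1` such that the number of odd
components of `G − S` equals `n − 8 + |S|`. Then `G` has at most `2n` edges. -/
theorem planar_tutteBerge_witness_edge_bound (n : ℕ) (hn : 11 ≤ n)
    (G : SimpleGraph (Fin n)) (hpl : G.IsPlanar)
    (h4 : ∃ M : Finset (Sym2 (Fin n)), IsMatchingOfSize G M 4)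
    (h5 : ¬ ∃ M : Finset (Sym2 (Fin n)), IsMatchingOfSize G M 5)
    (S : Finset (Fin n)) (hS : S.card ≤ 1)
    (hodd : oddComponentCount (G.induce ((↑S : Set (Fin n))ᶜ)) = n - 8 + S.card) :
    G.edgeSet.ncard ≤ 2 * n := by

  classical
  have hW := WeaklyDrawable.of_isPlanar hpl
  let H := G.induce ((↑S : Set (Fin n))ᶜ)
  let A : H.ConnectedComponent → Finset (Fin n) := fun C =>
    (C.supp.toFinset.image Subtype.val) ∪ S
  have hAc : ∀ C, (A C).card = C.supp.ncard + S.card := by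
    intro C
    rw [Finset.card_union_of_disjoint, Finset.card_image_of_injective _ Subtype.val_injective,
      Set.ncard_eq_toFinset_card']
    rw [Finset.disjoint_left]
    intro x hx hxS
    obtain ⟨y, -, rfl⟩ := Finset.mem_image.1 hx
    exact y.2 hxS
  let K : H.ConnectedComponent → SimpleGraph (Fin n) := fun C =>
    { Adj := fun x y => G.Adj x y ∧ x ∈ A C ∧ y ∈ A C
      symm := ⟨fun x y h => ⟨h.1.symm, h.2.2, h.2.1⟩⟩
      loopless := ⟨fun x h => h.1.ne rfl⟩ }
  have hKW : ∀ C, WeaklyDrawable (K C) := fun C => hW.mono (fun x y h => h.1)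
  have hKs : ∀ C x y, (K C).Adj x y → x ∈ A C := fun C x y h => h.2.1
  have hKch : ∀ C, (K C).edgeSet.ncard ≤ (C.supp.ncard + S.card).choose 2 := fun C => by
    rw [← hAc]; exact edges_le_choose _ _ (hKs C)
  have hKeu : ∀ C, 3 ≤ C.supp.ncard + S.card →
      (K C).edgeSet.ncard ≤ 3 * (C.supp.ncard + S.card) - 6 := fun C h =>
    WeaklyDrawable.edge_bound _ h (A C) (K C) (hAc C) (hKs C) (hKW C)
  have hpos : ∀ C : H.ConnectedComponent, 1 ≤ C.supp.ncard := fun C =>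
    (Set.ncard_pos (Set.toFinite _)).2 C.nonempty_supp
  -- every vertex outside `S` lies in its component
  have hmemA : ∀ x (hx : x ∈ ((↑S : Set (Fin n))ᶜ)), x ∈ A (H.connectedComponentMk ⟨x, hx⟩) := by
    intro x hx
    refine Finset.mem_union_left _ (Finset.mem_image.2 ⟨⟨x, hx⟩, ?_, rfl⟩)
    simp
  have hcover : ∀ x y, G.Adj x y → ∃ C, (K C).Adj x y := by
    have aux : ∀ x y, G.Adj x y → x ∉ S → ∃ C, (K C).Adj x y := by
      intro x y hxy hx
      have hx' : x ∈ ((↑S : Set (Fin n))ᶜ) := hx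
      refine ⟨H.connectedComponentMk ⟨x, hx'⟩, hxy, hmemA x hx', ?_⟩
      by_cases hy : y ∈ S
      · exact Finset.mem_union_right _ hy
      · have hy' : y ∈ ((↑S : Set (Fin n))ᶜ) := hy
        have : H.connectedComponentMk ⟨x, hx'⟩ = H.connectedComponentMk ⟨y, hy'⟩ :=
          SimpleGraph.ConnectedComponent.sound (SimpleGraph.Adj.reachable (by exact hxy))
        rw [this]; exact hmemA y hy'
    intro x y hxy
    by_cases hx : x ∈ S
    · have hy : y ∉ S := fun hy => hxy.ne (Finset.card_le_one.1 hS x hx y hy)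
      obtain ⟨C, hC⟩ := aux y x hxy.symm hy
      exact ⟨C, hC.symm⟩
    · exact aux x y hxy hx
  have hE : G.edgeSet.ncard ≤ ∑ C, (K C).edgeSet.ncard := by
    simp only [ncard_edgeSet_eq]
    refine (Finset.card_le_card ?_).trans Finset.card_biUnion_le
    intro e he
    rw [SimpleGraph.mem_edgeFinset] at he
    induction e with | _ x y =>
    obtain ⟨C, hC⟩ := hcover x y he
    exact Finset.mem_biUnion.2 ⟨C, Finset.mem_univ _, SimpleGraph.mem_edgeFinset.2 hC⟩
  have hsum : ∑ C : H.ConnectedComponent, C.supp.ncard + S.card = n := by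
    have h1 := Finset.card_eq_sum_card_fiberwise (f := H.connectedComponentMk)
      (s := Finset.univ) (t := Finset.univ) (fun _ _ => Finset.mem_coe.2 (Finset.mem_univ _))
    have h2 : ∑ C : H.ConnectedComponent, C.supp.ncard =
        ∑ C : H.ConnectedComponent, (Finset.univ.filter
          (fun x => H.connectedComponentMk x = C)).card := by
      refine Finset.sum_congr rfl fun C _ => ?_
      rw [Set.ncard_eq_toFinset_card']
      congr 1
      ext x
      simp
    rw [h2, ← h1, Finset.card_univ]
    have h3 : Fintype.card ↥((↑S : Set (Fin n))ᶜ) = n - S.card := by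
      rw [Fintype.card_compl_set]; simp
    have h4 : S.card ≤ n := by simpa using Finset.card_le_univ S
    rw [h3]; omega
  have hoddsum : ∑ C : H.ConnectedComponent, (if Odd C.supp.ncard then 1 else 0) =
      n - 8 + S.card := by
    rw [← hodd, oddComponentCount, Finset.sum_boole, Set.ncard_eq_toFinset_card']
    simp [H]
  have hS' : S.card = 0 ∨ S.card = 1 := by omega
  rcases hS' with h0 | h1
  · have hb : ∀ C : H.ConnectedComponent, (K C).edgeSet.ncard +
        3 * (if Odd C.supp.ncard then 1 else 0) +
        3 * (if C.supp.ncard = (if Odd C.supp.ncard then 1 else 0) then 0 else 1) ≤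
        3 * C.supp.ncard := by
      intro C
      have p := hpos C
      have a := hKch C
      have b := hKeu C
      rw [h0] at a b
      generalize C.supp.ncard = c at *
      rcases Nat.lt_or_ge c 3 with hc | hc
      · interval_cases c
        · simpa using a
        · have : ¬ Odd 2 := by decide
          have a' : (K C).edgeSet.ncard ≤ 1 := a
          simp only [this, if_false]
          norm_num
          omega
      · have := b (by omega)
        split_ifs <;> omega
    have hb' := Finset.sum_le_sum (s := Finset.univ) fun C _ => hb C
    simp only [Finset.sum_add_distrib, ← Finset.mul_sum, hoddsum] at hb'
    have hex : 1 ≤ ∑ C : H.ConnectedComponent,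
        (if C.supp.ncard = (if Odd C.supp.ncard then 1 else 0) then 0 else 1) := by
      by_contra hcon
      have hz : ∑ C : H.ConnectedComponent,
        (if C.supp.ncard = (if Odd C.supp.ncard then 1 else 0) then 0 else 1) = 0 := by omega
      rw [Finset.sum_eq_zero_iff] at hz
      have : ∑ C : H.ConnectedComponent, C.supp.ncard =
          ∑ C : H.ConnectedComponent, (if Odd C.supp.ncard then 1 else 0) := by
        refine Finset.sum_congr rfl fun C hC => ?_
        have := hz C hC
        by_contra hne
        simp [hne] at this
      omega
    omega
  · have hb : ∀ C : H.ConnectedComponent, (K C).edgeSet.ncard +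
        2 * (if Odd C.supp.ncard then 1 else 0) ≤ 3 * C.supp.ncard := by
      intro C
      have p := hpos C
      have a := hKch C
      have b := hKeu C
      rw [h1] at a b
      generalize C.supp.ncard = c at *
      rcases Nat.lt_or_ge c 2 with hc | hc
      · interval_cases c
        simp at a ⊢; omega
      · have := b (by omega)
        split_ifs <;> omega
    have hb' := Finset.sum_le_sum (s := Finset.univ) fun C _ => hb C
    simp only [Finset.sum_add_distrib, ← Finset.mul_sum, hoddsum] at hb'
    omega
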